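/- Let F = ℝ(x,y,z) be the field of fractions of ℝ[x,y,z] and let L be the intermediate field of F/ℝ generated by x², y², z², x·y·z. Then there do NOT exist elements s₁, s₂, s₃ of L, each of which is a sum of squares of elements of L, such that x²·z² = s₁ + s₂·x² + s₃·z². -/

import Mathlib

open MvPolynomial

/-- `F = ℝ(x,y,z)`, the field of fractions of `ℝ[x,y,z]`. -/
noncomputable abbrev F3 : Type := FractionRing (MvPolynomial (Fin 3) ℝ)

/-- The image of the variable `x` in `F = ℝ(x,y,z)`. -/
noncomputable def F3x : F3 := algebraMap (MvPolynomial (Fin 3) ℝ) F3 (X 0)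

/-- The image of the variable `y` in `F = ℝ(x,y,z)`. -/
noncomputable def F3y : F3 := algebraMap (MvPolynomial (Fin 3) ℝ) F3 (X 1)

/-- The image of the variable `z` in `F = ℝ(x,y,z)`. -/
noncomputable def F3z : F3 := algebraMap (MvPolynomial (Fin 3) ℝ) F3 (X 2)

/-- `L = ℝ(x², y², z², xyz)` as an intermediate field of `F/ℝ`. -/
noncomputable def L : IntermediateField ℝ F3 :=
  IntermediateField.adjoin ℝ {F3x ^ 2, F3y ^ 2, F3z ^ 2, F3x * F3y * F3z}

/-- `s` is a (finite) sum of squares of elements of the intermediate field `M`. -/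
def IsSumOfSquaresIn (M : IntermediateField ℝ F3) (s : F3) : Prop :=
  ∃ (n : ℕ) (t : Fin n → F3), (∀ i, t i ∈ M) ∧ s = ∑ i, t i ^ 2

/-- All exponents in the support of `p` have coordinates of the same parity. -/
def ParPoly (p : MvPolynomial (Fin 3) ℝ) : Prop :=
  ∀ d ∈ p.support, d 0 % 2 = d 1 % 2 ∧ d 0 % 2 = d 2 % 2

/-- The allowed leading exponents. -/
def GoodExp (d : Fin 3 →₀ ℕ) : Prop := ¬ ((d 0 + d 2) % 4 = 0 ∧ (d 0 + d 1) % 4 = 2)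

/-- The lexicographic monomial order. -/
noncomputable abbrev mo : MonomialOrder (Fin 3) := MonomialOrder.lex

/-- Zero, or positive leading coefficient with allowed leading exponent. -/
def PosPoly (p : MvPolynomial (Fin 3) ℝ) : Prop :=
  p = 0 ∨ (0 < mo.leadingCoeff p ∧ GoodExp (mo.degree p))

/-- Elements of `F3` which become `PosPoly` after multiplying by a square. -/
def PosFrac (s : F3) : Prop :=
  ∃ p q : MvPolynomial (Fin 3) ℝ, q ≠ 0 ∧ ParPoly q ∧ PosPoly p ∧
    s * (algebraMap _ F3 q) ^ 2 = algebraMap _ F3 p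

lemma ParPoly.add {p q : MvPolynomial (Fin 3) ℝ} (hp : ParPoly p) (hq : ParPoly q) :
    ParPoly (p + q) := by
  classical
  intro d hd
  rcases Finset.mem_union.1 (support_add hd) with h | h
  · exact hp d h
  · exact hq d h

lemma ParPoly.mul {p q : MvPolynomial (Fin 3) ℝ} (hp : ParPoly p) (hq : ParPoly q) :
    ParPoly (p * q) := by
  classical
  intro d hd
  obtain ⟨a, ha, b, hb, rfl⟩ := Finset.mem_add.1 (support_mul p q hd)
  have h1 := hp a ha
  have h2 := hq b hb
  simp only [Finsupp.add_apply]
  omega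

lemma ParPoly.monomial (d : Fin 3 →₀ ℕ) (c : ℝ)
    (h : d 0 % 2 = d 1 % 2 ∧ d 0 % 2 = d 2 % 2) : ParPoly (MvPolynomial.monomial d c) := by
  intro e he
  have := support_monomial_subset he
  rw [Finset.mem_singleton] at this
  rwa [this]

lemma ParPoly.const (c : ℝ) : ParPoly (C c) := ParPoly.monomial 0 c (by simp)

lemma ParPoly.Xsq (i : Fin 3) : ParPoly (X i ^ 2) := by
  rw [X_pow_eq_monomial]
  apply ParPoly.monomial
  fin_cases i <;> simp

lemma ParPoly.xyz : ParPoly (X 0 * X 1 * X 2) := by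
  have : (X 0 * X 1 * X 2 : MvPolynomial (Fin 3) ℝ) =
      MvPolynomial.monomial (Finsupp.single 0 1 + Finsupp.single 1 1 + Finsupp.single 2 1) 1 := by
    simp [X, monomial_mul]
  rw [this]
  apply ParPoly.monomial
  simp

lemma algMap_ne {q : MvPolynomial (Fin 3) ℝ} (h : q ≠ 0) : algebraMap _ F3 q ≠ 0 := by
  simpa using h

lemma mem_L {t : F3} (ht : t ∈ L) : ∃ p q : MvPolynomial (Fin 3) ℝ, q ≠ 0 ∧ ParPoly p ∧ ParPoly q ∧
    t * algebraMap _ F3 q = algebraMap _ F3 p := by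
  have h1 : ParPoly 1 := ParPoly.const 1
  unfold L at ht
  induction ht using IntermediateField.adjoin_induction with
  | mem x hx =>
    simp only [Set.mem_insert_iff, Set.mem_singleton_iff] at hx
    rcases hx with rfl | rfl | rfl | rfl
    · exact ⟨X 0 ^ 2, 1, one_ne_zero, .Xsq 0, h1, by simp [F3x]⟩
    · exact ⟨X 1 ^ 2, 1, one_ne_zero, .Xsq 1, h1, by simp [F3y]⟩
    · exact ⟨X 2 ^ 2, 1, one_ne_zero, .Xsq 2, h1, by simp [F3z]⟩
    · exact ⟨X 0 * X 1 * X 2, 1, one_ne_zero, .xyz, h1, by simp [F3x, F3y, F3z]⟩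
  | algebraMap c =>
    refine ⟨C c, 1, one_ne_zero, .const c, h1, ?_⟩
    rw [map_one, mul_one, IsScalarTower.algebraMap_apply ℝ (MvPolynomial (Fin 3) ℝ) F3]
    rfl
  | add x y hx hy ihx ihy =>
    obtain ⟨p, q, hq, pp, pq, e⟩ := ihx
    obtain ⟨p', q', hq', pp', pq', e'⟩ := ihy
    refine ⟨p * q' + p' * q, q * q', mul_ne_zero hq hq', (pp.mul pq').add (pp'.mul pq),
      pq.mul pq', ?_⟩
    simp only [map_add, map_mul, ← e, ← e']
    ring
  | mul x y hx hy ihx ihy =>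
    obtain ⟨p, q, hq, pp, pq, e⟩ := ihx
    obtain ⟨p', q', hq', pp', pq', e'⟩ := ihy
    refine ⟨p * p', q * q', mul_ne_zero hq hq', pp.mul pp', pq.mul pq', ?_⟩
    simp only [map_mul, ← e, ← e']
    ring
  | inv x hx ih =>
    obtain ⟨p, q, hq, pp, pq, e⟩ := ih
    by_cases hx0 : x = 0
    · exact ⟨0, 1, one_ne_zero, by simp [ParPoly], h1, by simp [hx0]⟩
    · refine ⟨q, p, ?_, pq, pp, ?_⟩
      · rintro rfl
        rw [map_zero] at e
        exact mul_ne_zero hx0 (algMap_ne hq) e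
      · rw [← e, inv_mul_cancel_left₀ hx0]

lemma PosPoly.add {p q : MvPolynomial (Fin 3) ℝ} (hp : PosPoly p) (hq : PosPoly q) :
    PosPoly (p + q) := by
  rcases hp with rfl | ⟨cp, gp⟩
  · simpa using hq
  rcases hq with rfl | ⟨cq, gq⟩
  · rw [add_zero]; exact Or.inr ⟨cp, gp⟩
  right
  rcases lt_trichotomy (mo.toSyn (mo.degree p)) (mo.toSyn (mo.degree q)) with h | h | h
  · rw [add_comm, MonomialOrder.leadingCoeff_add_of_lt h, MonomialOrder.degree_add_of_lt h]
    exact ⟨cq, gq⟩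
  · have hd : mo.degree p = mo.degree q := mo.toSyn.injective h
    have hc : 0 < (p + q).coeff (mo.degree p) := by
      rw [coeff_add]
      nth_rewrite 2 [hd]
      exact add_pos cp cq
    have hdeg : mo.degree (p + q) = mo.degree p := by
      apply mo.toSyn.injective
      apply le_antisymm
      · refine MonomialOrder.degree_add_le.trans ?_
        rw [h, sup_idem]
      · exact MonomialOrder.le_degree (mem_support_iff.2 hc.ne')
    rw [MonomialOrder.leadingCoeff, hdeg]
    exact ⟨hc, gp⟩
  · rw [MonomialOrder.leadingCoeff_add_of_lt h, MonomialOrder.degree_add_of_lt h]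
    exact ⟨cp, gp⟩

lemma lead_mul_sq {p q : MvPolynomial (Fin 3) ℝ} (hp : p ≠ 0) (hq : q ≠ 0) (h : ParPoly q) :
    mo.leadingCoeff (p * q ^ 2) = mo.leadingCoeff p * mo.leadingCoeff q ^ 2 ∧
    (GoodExp (mo.degree (p * q ^ 2)) ↔ GoodExp (mo.degree p)) := by
  have h1 : mo.leadingCoeff p ≠ 0 := MonomialOrder.leadingCoeff_ne_zero_iff.2 hp
  have h2 : mo.leadingCoeff q ≠ 0 := MonomialOrder.leadingCoeff_ne_zero_iff.2 hq
  constructor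
  · rw [MonomialOrder.leadingCoeff_mul_of_mul_leadingCoeff_ne_zero, MonomialOrder.leadingCoeff_pow]
    rw [MonomialOrder.leadingCoeff_pow]
    positivity
  · rw [MonomialOrder.degree_mul hp (pow_ne_zero 2 hq), MonomialOrder.degree_pow]
    have := h _ (MonomialOrder.degree_mem_support (m := mo) hq)
    simp only [GoodExp, Finsupp.add_apply, Finsupp.smul_apply, smul_eq_mul]
    omega

lemma PosPoly.mul_sq {p q : MvPolynomial (Fin 3) ℝ} (hp : PosPoly p) (hq : ParPoly q) :
    PosPoly (p * q ^ 2) := by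
  by_cases hq0 : q = 0
  · left; simp [hq0]
  rcases hp with rfl | ⟨cp, gp⟩
  · left; simp
  have hp0 : p ≠ 0 := by rintro rfl; simp at cp
  have h2 : mo.leadingCoeff q ≠ 0 := MonomialOrder.leadingCoeff_ne_zero_iff.2 hq0
  obtain ⟨a, b⟩ := lead_mul_sq hp0 hq0 hq
  right
  rw [a, b]
  exact ⟨by positivity, gp⟩

lemma PosFrac.zero : PosFrac 0 := ⟨0, 1, one_ne_zero, ParPoly.const 1, Or.inl rfl, by simp⟩

lemma PosFrac.add {s t : F3} (hs : PosFrac s) (ht : PosFrac t) : PosFrac (s + t) := by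
  obtain ⟨p, q, hq, pq, pp, e⟩ := hs
  obtain ⟨p', q', hq', pq', pp', e'⟩ := ht
  refine ⟨p * q' ^ 2 + p' * q ^ 2, q * q', mul_ne_zero hq hq', pq.mul pq',
    (pp.mul_sq pq').add (pp'.mul_sq pq), ?_⟩
  simp only [map_add, map_mul, map_pow, ← e, ← e']
  ring

lemma PosFrac.sum {s : F3} (hs : IsSumOfSquaresIn L s) {u : MvPolynomial (Fin 3) ℝ}
    (hu : PosPoly u) : PosFrac (s * algebraMap _ F3 u) := by
  obtain ⟨n, t, ht, rfl⟩ := hs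
  rw [Finset.sum_mul]
  refine Finset.sum_induction _ PosFrac (fun _ _ => PosFrac.add) PosFrac.zero ?_
  intro i _
  obtain ⟨p, q, hq, pp, pq, e⟩ := mem_L (ht i)
  refine ⟨u * p ^ 2, q, hq, pq, hu.mul_sq pp, ?_⟩
  simp only [map_mul, map_pow, ← e]
  ring

lemma PosPoly.one : PosPoly 1 := by
  right
  simp [GoodExp, MonomialOrder.leadingCoeff_one]

lemma PosPoly.Xsq {i : Fin 3} (hi : i = 0 ∨ i = 2) : PosPoly (X i ^ 2) := by
  right
  rw [MonomialOrder.leadingCoeff_pow, MonomialOrder.degree_pow, MonomialOrder.degree_X,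
    MonomialOrder.leadingCoeff_X]
  rcases hi with rfl | rfl <;> simp [GoodExp]

theorem stmt6 :
    ¬ ∃ s₁ s₂ s₃ : F3,
        IsSumOfSquaresIn L s₁ ∧ IsSumOfSquaresIn L s₂ ∧ IsSumOfSquaresIn L s₃ ∧
        F3x ^ 2 * F3z ^ 2 = s₁ + s₂ * F3x ^ 2 + s₃ * F3z ^ 2 := by
  rintro ⟨s₁, s₂, s₃, h₁, h₂, h₃, e⟩
  have H := ((PosFrac.sum h₁ PosPoly.one).add (PosFrac.sum h₂ (PosPoly.Xsq (i := 0) (by simp)))).add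
    (PosFrac.sum h₃ (PosPoly.Xsq (i := 2) (by simp)))
  rw [map_one, mul_one, map_pow, map_pow] at H
  change PosFrac (s₁ + s₂ * F3x ^ 2 + s₃ * F3z ^ 2) at H
  rw [← e] at H
  obtain ⟨p, q, hq, pq, pp, e⟩ := H
  have hX : (X 0 ^ 2 * X 2 ^ 2 : MvPolynomial (Fin 3) ℝ) ≠ 0 :=
    mul_ne_zero (pow_ne_zero 2 (X_ne_zero 0)) (pow_ne_zero 2 (X_ne_zero 2))
  have e2 : X 0 ^ 2 * X 2 ^ 2 * q ^ 2 = p := by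
    apply IsFractionRing.injective (MvPolynomial (Fin 3) ℝ) F3
    rw [← e]
    simp [F3x, F3z]
  rcases pp with rfl | ⟨_, g⟩
  · exact mul_ne_zero hX (pow_ne_zero 2 hq) e2
  · rw [← e2, (lead_mul_sq hX hq pq).2, MonomialOrder.degree_mul (pow_ne_zero 2 (X_ne_zero 0))
      (pow_ne_zero 2 (X_ne_zero 2)), MonomialOrder.degree_pow, MonomialOrder.degree_pow,
      MonomialOrder.degree_X, MonomialOrder.degree_X] at g
    simp [GoodExp] at g
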